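/- arXiv:2310.06478 — 3 statements merged into one kernel-verified Lean document; each statement's English description precedes it below -/
import Mathlib

section
/- Let Ω ⊂ ℝⁿ (n ≥ 1) be a bounded domain with Lipschitz boundary, α ≥ 0, β ≥ 1. Suppose β < n and p satisfies n(α+β)/(α+n) ≤ p < n. Then there exist constants C, C₁ > 0 (depending on α, β, p, n, Ω) such that for every u ∈ C¹(Ω̄) vanishing on ∂Ω and every i ∈ {1,…,n}, ∫_Ω |u|^α |D_i u|^β dx ≤ C (‖u‖_{L^p(Ω)} + ‖∇u‖_{L^p(Ω)})^{αp/(p−β)} + C₁ (‖u‖_{L^p(Ω)} + ‖∇u‖_{L^p(Ω)})^p. In particular, every u ∈ W₀^{1,p}(Ω) belongs to the pn-space S̊_{1,α,β}(Ω). -/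
open MeasureTheory Real Set

section

open Filter Topology

/-- A smooth function vanishing on `[-1, 1]`, equal to the identity outside `(-2, 2)`, with bounded
derivative. -/
theorem exists_contDiff_eq_zero_near_zero_eq_id :
    ∃ (φ : ℝ → ℝ) (K : ℝ), ContDiff ℝ 1 φ ∧ (∀ t, |t| ≤ 1 → φ t = 0) ∧
      (∀ t, 2 ≤ |t| → φ t = t) ∧ ∀ t, |deriv φ t| ≤ K := by
  set φ : ℝ → ℝ := fun t => t * Real.smoothTransition (t ^ 2 - 1) with hφ
  have hc : ContDiff ℝ 1 φ :=
    contDiff_id.mul (Real.smoothTransition.contDiff.comp ((contDiff_id.pow 2).sub contDiff_const))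
  have hid : ∀ t, 2 ≤ |t| → φ t = t := by
    intro t ht
    have : Real.smoothTransition (t ^ 2 - 1) = 1 :=
      Real.smoothTransition.one_of_one_le (by nlinarith [sq_abs t])
    simp [hφ, this]
  obtain ⟨K, hK⟩ := (isCompact_Icc (a := (-2 : ℝ)) (b := 2)).exists_bound_of_continuousOn
    (hc.continuous_deriv le_rfl).continuousOn
  refine ⟨φ, max K 1, hc, fun t ht => ?_, hid, fun t => ?_⟩
  · have : Real.smoothTransition (t ^ 2 - 1) = 0 :=
      Real.smoothTransition.zero_of_nonpos (by nlinarith [sq_abs t, abs_nonneg t])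
    simp [hφ, this]
  · rcases le_or_gt |t| 2 with h | h
    · exact (hK t (abs_le.1 h)).trans (le_max_left _ _)
    · have : φ =ᶠ[𝓝 t] id := by
        filter_upwards [continuous_abs.continuousAt.eventually (lt_mem_nhds h)] with s hs
        exact hid s hs.le
      rw [this.deriv_eq]
      simp

/-- The identity of `ℝ` is a pointwise limit of `C¹` functions vanishing near `0` with uniformly
bounded derivatives. -/
theorem exists_seq_contDiff_eventually_eq_zero_tendsto_id :
    ∃ (ψ : ℕ → ℝ → ℝ) (K : ℝ), (∀ k, ContDiff ℝ 1 (ψ k)) ∧ (∀ k, ∀ᶠ t in 𝓝 0, ψ k t = 0) ∧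
      (∀ k t, |deriv (ψ k) t| ≤ K) ∧ ∀ t, Tendsto (fun k => ψ k t) atTop (𝓝 t) := by
  obtain ⟨φ, K, hφ, hφ0, hφid, hK⟩ := exists_contDiff_eq_zero_near_zero_eq_id
  set ψ : ℕ → ℝ → ℝ := fun k t => ((k : ℝ) + 1)⁻¹ * φ ((k + 1) * t) with hψ
  have hkpos : ∀ k : ℕ, (0 : ℝ) < k + 1 := fun k => by positivity
  have hψc : ∀ k, ContDiff ℝ 1 (ψ k) := fun k =>
    contDiff_const.mul (hφ.comp (contDiff_const.mul contDiff_id))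
  have hψ0 : ∀ k, ∀ᶠ t in 𝓝 0, ψ k t = 0 := by
    intro k
    have : Tendsto (fun t : ℝ => |((k : ℝ) + 1) * t|) (𝓝 0) (𝓝 0) := by
      have h : Continuous (fun t : ℝ => |((k : ℝ) + 1) * t|) := by fun_prop
      simpa using h.tendsto 0
    filter_upwards [this.eventually (gt_mem_nhds one_pos)] with t ht
    simp [hψ, hφ0 _ ht.le]
  have hψK : ∀ k t, |deriv (ψ k) t| ≤ K := by
    intro k t
    have h : HasDerivAt (ψ k) (((k : ℝ) + 1)⁻¹ * (deriv φ ((k + 1) * t) * ((k + 1) * 1))) t :=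
      (((hφ.differentiable one_ne_zero _).hasDerivAt).comp t
        ((hasDerivAt_id t).const_mul _)).const_mul _
    have h' : ((k : ℝ) + 1)⁻¹ * (deriv φ ((k + 1) * t) * ((k + 1) * 1))
        = deriv φ ((k + 1) * t) := by
      have := (hkpos k).ne'
      field_simp
    rw [h.deriv, h']
    exact hK _
  have hψlim : ∀ t, Tendsto (fun k => ψ k t) atTop (𝓝 t) := by
    intro t
    by_cases ht : t = 0
    · subst ht
      simp [hψ, hφ0 0 (by simp)]
    · refine tendsto_const_nhds.congr' ?_
      obtain ⟨N, hN⟩ := exists_nat_ge (2 / |t|)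
      filter_upwards [eventually_ge_atTop N] with k hk
      have h2 : 2 ≤ |((k : ℝ) + 1) * t| := by
        rw [abs_mul, abs_of_pos (hkpos k), ← div_le_iff₀ (abs_pos.2 ht)]
        have : (N : ℝ) ≤ k := by exact_mod_cast hk
        linarith
      have := (hkpos k).ne'
      simp only [hψ, hφid _ h2]
      field_simp
  exact ⟨ψ, K, hψc, hψ0, hψK, hψlim⟩

/-- If `u` is `C¹` on the closure of a bounded open set `s`, its derivative is bounded on `s`. -/
theorem exists_bound_fderiv_of_contDiffOn_closure {E F : Type*} [NormedAddCommGroup E]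
    [NormedSpace ℝ E] [ProperSpace E] [NormedAddCommGroup F] [NormedSpace ℝ F] {s : Set E}
    (hs : IsOpen s) (hb : Bornology.IsBounded s) {u : E → F} (hu : ContDiffOn ℝ 1 u (closure s)) :
    ∃ M, ∀ x ∈ s, ‖fderiv ℝ u x‖ ≤ M := by
  have key : ∃ M, ∀ x ∈ closure s ∩ s, ‖fderiv ℝ u x‖ ≤ M := by
    refine hb.isCompact_closure.induction_on (p := fun t => ∃ M, ∀ x ∈ t ∩ s, ‖fderiv ℝ u x‖ ≤ M)
      ⟨0, by simp⟩ ?_ ?_ ?_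
    · rintro t t' htt' ⟨M, hM⟩
      exact ⟨M, fun x hx => hM x ⟨htt' hx.1, hx.2⟩⟩
    · rintro t t' ⟨M, hM⟩ ⟨M', hM'⟩
      refine ⟨max M M', fun x hx => ?_⟩
      rcases hx.1 with h | h
      · exact (hM x ⟨h, hx.2⟩).trans (le_max_left _ _)
      · exact (hM' x ⟨h, hx.2⟩).trans (le_max_right _ _)
    · intro x hx
      have h1 : ContDiffWithinAt ℝ (0 + 1) u (closure s) x := by simpa using hu x hx
      obtain ⟨t, ht, -, -, f', hf', hcf'⟩ :=
        (contDiffWithinAt_succ_iff_hasFDerivWithinAt' (by simp)).1 h1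
      rw [insert_eq_of_mem hx] at ht
      have hlt : ∀ᶠ y in 𝓝[closure s] x, ‖f' y‖ < ‖f' x‖ + 1 :=
        hcf'.continuousWithinAt.norm.eventually (gt_mem_nhds (lt_add_one _))
      refine ⟨_, Filter.inter_mem ht hlt, ‖f' x‖ + 1, fun y hy => ?_⟩
      have : HasFDerivAt u (f' y) y :=
        (hf' y hy.1.1).hasFDerivAt (Filter.mem_of_superset (hs.mem_nhds hy.2) subset_closure)
      rw [this.fderiv]
      exact le_of_lt hy.1.2
  obtain ⟨M, hM⟩ := key
  exact ⟨M, fun x hx => hM x ⟨subset_closure hx, hx⟩⟩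

theorem indicator_comp_eventuallyEq_zero {E : Type*} [TopologicalSpace E] {s : Set E}
    {u : E → ℝ} (hu : ContinuousOn u (closure s)) {ψ : ℝ → ℝ} (hψ : ∀ᶠ t in 𝓝 0, ψ t = 0)
    (h0 : ∀ x ∈ frontier s, u x = 0) (hs : IsOpen s) {x : E} (hx : x ∉ s) :
    s.indicator (ψ ∘ u) =ᶠ[𝓝 x] 0 := by
  by_cases hxc : x ∈ closure s
  · have hux : u x = 0 := h0 x (by rw [hs.frontier_eq]; exact ⟨hxc, hx⟩)
    have h1 : ∀ᶠ y in 𝓝[closure s] x, ψ (u y) = 0 := by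
      have := hu x hxc
      rw [ContinuousWithinAt, hux] at this
      exact this.eventually hψ
    filter_upwards [eventually_nhdsWithin_iff.1 h1] with y hy
    by_cases hys : y ∈ s
    · simpa [hys] using hy (subset_closure hys)
    · simp [hys]
  · filter_upwards [isClosed_closure.isOpen_compl.mem_nhds hxc] with y hy
    exact indicator_of_notMem (fun h => hy (subset_closure h)) _

/-- Sobolev's inequality for functions which are `C¹` on the closure of a bounded open set and
vanish on its boundary, without any regularity of the boundary. -/
theorem exists_eLpNorm_restrict_le_eLpNorm_fderiv {E : Type*} [NormedAddCommGroup E]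
    [NormedSpace ℝ E] [FiniteDimensional ℝ E] [MeasurableSpace E] [BorelSpace E]
    (μ : Measure E) [μ.IsAddHaarMeasure] {s : Set E} (hs : IsOpen s)
    (hb : Bornology.IsBounded s) {p q : NNReal} (hp : 1 ≤ p) (hpn : p < Module.finrank ℝ E)
    (hpq : (p : ℝ)⁻¹ - (Module.finrank ℝ E : ℝ)⁻¹ ≤ (q : ℝ)⁻¹) :
    ∃ C : NNReal, ∀ u : E → ℝ, ContDiffOn ℝ 1 u (closure s) → (∀ x ∈ frontier s, u x = 0) →
      eLpNorm u q (μ.restrict s) ≤ C * eLpNorm (fderiv ℝ u) p (μ.restrict s) := by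
  obtain ⟨ψ, K, hψc, hψ0, hψK, hψlim⟩ := exists_seq_contDiff_eventually_eq_zero_tendsto_id
  obtain ⟨C, hC⟩ : ∃ C : NNReal, ∀ v : E → ℝ, ContDiff ℝ 1 v → v.support ⊆ s →
      eLpNorm v q μ ≤ C * eLpNorm (fderiv ℝ v) p μ :=
    ⟨_, fun v hv hvs => eLpNorm_le_eLpNorm_fderiv_of_le μ hv hvs hp hpn hpq hb⟩
  refine ⟨C * K.toNNReal, fun u hu h0 => ?_⟩
  set v : ℕ → E → ℝ := fun k => s.indicator (ψ k ∘ u) with hv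
  have hnhds : ∀ x ∈ s, closure s ∈ 𝓝 x := fun x hx =>
    Filter.mem_of_superset (hs.mem_nhds hx) subset_closure
  have hvin : ∀ k, ∀ x ∈ s, v k =ᶠ[𝓝 x] ψ k ∘ u := fun k x hx => by
    filter_upwards [hs.mem_nhds hx] with y hy
    simp [hv, hy]
  have hvout : ∀ k, ∀ x ∉ s, v k =ᶠ[𝓝 x] 0 := fun k x hx =>
    indicator_comp_eventuallyEq_zero hu.continuousOn (hψ0 k) h0 hs hx
  have hvc : ∀ k, ContDiff ℝ 1 (v k) := fun k => contDiff_iff_contDiffAt.2 fun x => by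
    by_cases hx : x ∈ s
    · exact ((hψc k).contDiffAt.comp x (hu.contDiffAt (hnhds x hx))).congr_of_eventuallyEq
        (hvin k x hx)
    · exact (contDiffAt_const (c := (0 : ℝ))).congr_of_eventuallyEq (hvout k x hx)
  have hvd : ∀ k x, ‖fderiv ℝ (v k) x‖ ≤ K * ‖s.indicator (fun y => ‖fderiv ℝ u y‖) x‖ := by
    intro k x
    by_cases hx : x ∈ s
    · have hd : DifferentiableAt ℝ u x :=
        (hu.contDiffAt (hnhds x hx)).differentiableAt one_ne_zero
      have : HasFDerivAt (ψ k ∘ u) (deriv (ψ k) (u x) • fderiv ℝ u x) x :=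
        ((hψc k).differentiable one_ne_zero _).hasDerivAt.comp_hasFDerivAt x hd.hasFDerivAt
      rw [(hvin k x hx).fderiv_eq, this.fderiv, norm_smul, indicator_of_mem hx, norm_norm]
      exact mul_le_mul_of_nonneg_right (hψK _ _) (norm_nonneg _)
    · rw [(hvout k x hx).fderiv_eq]
      simp [hx]
  have hbound : ∀ k, eLpNorm (v k) q (μ.restrict s) ≤
      (C * K.toNNReal : NNReal) *
        eLpNorm (fderiv ℝ u) p (μ.restrict s) := by
    intro k
    calc eLpNorm (v k) q (μ.restrict s) ≤ eLpNorm (v k) q μ :=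
          eLpNorm_mono_measure _ Measure.restrict_le_self
      _ ≤ C * eLpNorm (fderiv ℝ (v k)) p μ :=
          hC _ (hvc k) support_indicator_subset
      _ ≤ C *
            (ENNReal.ofReal K * eLpNorm (s.indicator fun y => ‖fderiv ℝ u y‖) p μ) := by
          gcongr
          exact eLpNorm_le_mul_eLpNorm_of_ae_le_mul (Eventually.of_forall (hvd k)) _
      _ = _ := by
          rw [eLpNorm_indicator_eq_eLpNorm_restrict hs.measurableSet, eLpNorm_norm, ← mul_assoc, ENNReal.coe_mul, ENNReal.ofReal]
  refine Lp.eLpNorm_le_of_ae_tendsto (u := atTop) (Eventually.of_forall hbound)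
    (fun k => (hvc k).continuous.aestronglyMeasurable) ?_
  filter_upwards [ae_restrict_mem hs.measurableSet] with x hx
  simpa [hv, hx] using hψlim (u x)

theorem memLp_of_continuousOn_of_norm_le {E F : Type*} [TopologicalSpace E] [MeasurableSpace E]
    [OpensMeasurableSpace E] [SecondCountableTopology E] [NormedAddCommGroup F] {μ : Measure E}
    {s : Set E} (hs : MeasurableSet s) (hμ : μ s ≠ ⊤) {f : E → F} (hf : ContinuousOn f s) {M : ℝ}
    (hM : ∀ x ∈ s, ‖f x‖ ≤ M) (r : ENNReal) : MemLp f r (μ.restrict s) := by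
  have : IsFiniteMeasure (μ.restrict s) := ⟨by simpa using hμ.lt_top⟩
  exact MemLp.of_bound (hf.aestronglyMeasurable hs) M ((ae_restrict_iff' hs).2 (ae_of_all _ hM))

theorem rpow_mul_rpow_le_rpow_add_rpow {a b α β p : ℝ} (ha : 0 ≤ a) (hb : 0 ≤ b) (hβ : 0 < β)
    (hβp : β < p) : a ^ α * b ^ β ≤ a ^ (α * p / (p - β)) + b ^ p := by
  have hp : 0 < p := hβ.trans hβp
  have hpβ : 0 < p - β := sub_pos.2 hβp
  have hconj : (p / (p - β)).HolderConjugate (p / β) := by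
    rw [Real.holderConjugate_iff]
    refine ⟨(one_lt_div hpβ).2 (by linarith), ?_⟩
    field_simp
    ring
  have h := Real.young_inequality_of_nonneg (rpow_nonneg ha α) (rpow_nonneg hb β) hconj
  rw [← rpow_mul ha, ← rpow_mul hb, mul_div_cancel₀ p hβ.ne', ← mul_div_assoc] at h
  exact h.trans (add_le_add (div_le_self (rpow_nonneg ha _) hconj.lt.le)
    (div_le_self (rpow_nonneg hb _) hconj.symm.lt.le))

theorem rpow_le_one_add_rpow {b β p : ℝ} (hb : 0 ≤ b) (hβ : 0 ≤ β) (hβp : β ≤ p) :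
    b ^ β ≤ 1 + b ^ p := by
  rcases le_total b 1 with h | h
  · exact (rpow_le_one hb h hβ).trans (le_add_of_nonneg_right (rpow_nonneg hb p))
  · exact (rpow_le_rpow_of_exponent_le h hβp).trans (le_add_of_nonneg_left zero_le_one)

theorem integral_rpow_norm_le_of_eLpNorm_le {X F G : Type*} [MeasurableSpace X] {μ : Measure X}
    [NormedAddCommGroup F] [NormedAddCommGroup G] {f : X → F} {g : X → G} {p q : NNReal}
    (hp : p ≠ 0) (hq : q ≠ 0) (hf : MemLp f q μ) (hg : MemLp g p μ) {C : NNReal}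
    (h : eLpNorm f q μ ≤ C * eLpNorm g p μ) :
    ∫ x, ‖f x‖ ^ (q : ℝ) ∂μ ≤ (C * (∫ x, ‖g x‖ ^ (p : ℝ) ∂μ) ^ (1 / (p : ℝ))) ^ (q : ℝ) := by
  have hA : 0 ≤ ∫ x, ‖f x‖ ^ (q : ℝ) ∂μ := integral_nonneg fun x => by positivity
  have hB : 0 ≤ ∫ x, ‖g x‖ ^ (p : ℝ) ∂μ := integral_nonneg fun x => by positivity
  rw [hf.eLpNorm_eq_integral_rpow_norm (by simpa using hq) ENNReal.coe_ne_top,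
    hg.eLpNorm_eq_integral_rpow_norm (by simpa using hp) ENNReal.coe_ne_top,
    ← ENNReal.ofReal_coe_nnreal (p := C), ← ENNReal.ofReal_mul C.coe_nonneg,
    ENNReal.ofReal_le_ofReal_iff (by positivity)] at h
  simp only [ENNReal.coe_toReal] at h
  rw [one_div]
  calc ∫ x, ‖f x‖ ^ (q : ℝ) ∂μ = ((∫ x, ‖f x‖ ^ (q : ℝ) ∂μ) ^ (q : ℝ)⁻¹) ^ (q : ℝ) :=
        (rpow_inv_rpow hA (by simpa using hq)).symm
    _ ≤ _ := rpow_le_rpow (by positivity) h q.coe_nonneg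

end

/-- Theorem 3.1, case (iii): Let `Ω ⊂ ℝⁿ` be a bounded domain with
(Lipschitz) boundary, `α ≥ 0`, `β ≥ 1`, `β < n` and `n(α+β)/(α+n) ≤ p < n`.  Then
there are constants `C, C₁ > 0` such that for every `u ∈ C¹(Ω̄)` vanishing on `∂Ω`
and every `i`,
`∫_Ω |u|^α |D_i u|^β ≤ C‖u‖_{W^{1,p}}^{αp/(p-β)} + C₁‖u‖_{W^{1,p}}^p`,
where `‖u‖_{W^{1,p}} = ‖u‖_{L^p(Ω)} + ‖∇u‖_{L^p(Ω)}`.  In particular every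
`u ∈ W₀^{1,p}(Ω)` belongs to `S̊_{1,α,β}(Ω)`. -/
theorem stmt_3 (n : ℕ) (hn : 1 ≤ n) (Ω : Set (Fin n → ℝ))
    (hΩ_open : IsOpen Ω) (hΩ_bdd : Bornology.IsBounded Ω) (hΩ_conn : IsConnected Ω)
    (α β p : ℝ) (hα : 0 ≤ α) (hβ : 1 ≤ β) (hβn : β < n)
    (hp₁ : (n * (α + β)) / (α + n) ≤ p) (hp₂ : p < n) :
    ∃ C C₁ : ℝ, 0 < C ∧ 0 < C₁ ∧
      ∀ u : (Fin n → ℝ) → ℝ, ContDiffOn ℝ 1 u (closure Ω) →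
        (∀ x ∈ frontier Ω, u x = 0) → ∀ i : Fin n,
        (∫ x in Ω, |u x| ^ α * |fderiv ℝ u x (Pi.single i 1)| ^ β) ≤
          C * ((∫ x in Ω, |u x| ^ p) ^ (1 / p) +
               (∫ x in Ω, ‖fderiv ℝ u x‖ ^ p) ^ (1 / p)) ^ (α * p / (p - β)) +
          C₁ * ((∫ x in Ω, |u x| ^ p) ^ (1 / p) +
               (∫ x in Ω, ‖fderiv ℝ u x‖ ^ p) ^ (1 / p)) ^ p := by
  have hn0 : (0 : ℝ) < n := by linarith
  have hβ0 : 0 < β := by linarith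
  have hαn : 0 < α + n := by linarith
  have hp₁' : n * (α + β) ≤ p * (α + n) := (div_le_iff₀ hαn).1 hp₁
  have hβp : β ≤ p := by
    refine le_trans ?_ hp₁
    rw [le_div_iff₀ hαn]
    nlinarith
  have hp0 : 0 < p := hβ0.trans_le hβp
  have hvol : volume Ω ≠ ⊤ := hΩ_bdd.measure_lt_top.ne
  have hmeas := hΩ_open.measurableSet
  have hfin : IsFiniteMeasure (volume.restrict Ω) := ⟨by simpa using hvol.lt_top⟩
  have hderiv : ∀ u : (Fin n → ℝ) → ℝ, ContDiffOn ℝ 1 u (closure Ω) →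
      MemLp (fderiv ℝ u) (ENNReal.ofReal p) (volume.restrict Ω) := fun u hu => by
    obtain ⟨M, hM⟩ := exists_bound_fderiv_of_contDiffOn_closure hΩ_open hΩ_bdd hu
    exact memLp_of_continuousOn_of_norm_le hmeas hvol
      ((hu.mono subset_closure).continuousOn_fderiv_of_isOpen hΩ_open le_rfl) hM _
  have hderiv_int : ∀ u : (Fin n → ℝ) → ℝ, ContDiffOn ℝ 1 u (closure Ω) →
      Integrable (fun x => ‖fderiv ℝ u x‖ ^ p) (volume.restrict Ω) := fun u hu => by
    simpa [ENNReal.toReal_ofReal hp0.le] using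
      (hderiv u hu).integrable_norm_rpow (by simpa using hp0) ENNReal.ofReal_ne_top
  have hpartial : ∀ (u : (Fin n → ℝ) → ℝ) x (i : Fin n),
      |fderiv ℝ u x (Pi.single i 1)| ^ β ≤ ‖fderiv ℝ u x‖ ^ β := fun u x i => by
    refine rpow_le_rpow (abs_nonneg _) ?_ hβ0.le
    simpa [Pi.norm_single] using (fderiv ℝ u x).le_opNorm (Pi.single i 1)
  have hgrad : ∀ u : (Fin n → ℝ) → ℝ, ∫ x in Ω, ‖fderiv ℝ u x‖ ^ p ≤
      ((∫ x in Ω, |u x| ^ p) ^ (1 / p) + (∫ x in Ω, ‖fderiv ℝ u x‖ ^ p) ^ (1 / p)) ^ p :=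
    fun u => by
    have hA : 0 ≤ ∫ x in Ω, |u x| ^ p := integral_nonneg fun x => by positivity
    have hB : 0 ≤ ∫ x in Ω, ‖fderiv ℝ u x‖ ^ p := integral_nonneg fun x => by positivity
    calc ∫ x in Ω, ‖fderiv ℝ u x‖ ^ p = ((∫ x in Ω, ‖fderiv ℝ u x‖ ^ p) ^ (1 / p)) ^ p := by
          rw [one_div, rpow_inv_rpow hB hp0.ne']
      _ ≤ _ := rpow_le_rpow (by positivity) (le_add_of_nonneg_left (by positivity)) hp0.le
  rcases hα.eq_or_lt with rfl | hα0
  · refine ⟨volume.real Ω + 1, 1, by positivity, one_pos, fun u hu _ i => ?_⟩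
    simp only [rpow_zero, one_mul, zero_mul, zero_div, mul_one]
    calc ∫ x in Ω, |fderiv ℝ u x (Pi.single i 1)| ^ β
        ≤ ∫ x in Ω, (1 + ‖fderiv ℝ u x‖ ^ p) := by
          refine integral_mono_of_nonneg (ae_of_all _ fun x => by positivity)
            ((integrable_const 1).add (hderiv_int u hu)) (ae_of_all _ fun x => ?_)
          exact (hpartial u x i).trans (rpow_le_one_add_rpow (norm_nonneg _) hβ0.le hβp)
      _ = volume.real Ω + ∫ x in Ω, ‖fderiv ℝ u x‖ ^ p := by
          rw [integral_add (integrable_const 1) (hderiv_int u hu)]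
          simp
      _ ≤ _ := by linarith [hgrad u]
  · have hβp' : β < p := by
      by_contra! h
      nlinarith [mul_pos hα0 (sub_pos.2 hβn)]
    have hpβ : 0 < p - β := sub_pos.2 hβp'
    set q : ℝ := α * p / (p - β) with hq
    have hq0 : 0 < q := by positivity
    have hexp : p⁻¹ - (n : ℝ)⁻¹ ≤ q⁻¹ := by
      rw [hq, inv_div, inv_sub_inv hp0.ne' hn0.ne', div_le_div_iff₀ (by positivity) (by positivity)]
      nlinarith
    obtain ⟨C, hC⟩ := exists_eLpNorm_restrict_le_eLpNorm_fderiv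
      (volume : Measure (Fin n → ℝ)) hΩ_open hΩ_bdd
      (p := p.toNNReal) (q := q.toNNReal) (by simpa using hβ.trans hβp)
      (by
        rw [← NNReal.coe_lt_coe, Real.coe_toNNReal _ hp0.le]
        simpa using hp₂)
      (by simpa [hp0.le, hq0.le] using hexp)
    refine ⟨C ^ q + 1, 1, by positivity, one_pos, fun u hu h0 i => ?_⟩
    obtain ⟨M, hM⟩ := hΩ_bdd.isCompact_closure.exists_bound_of_continuousOn hu.continuousOn
    have hu_memLp : MemLp u (ENNReal.ofReal q) (volume.restrict Ω) :=
      memLp_of_continuousOn_of_norm_le hmeas hvol (hu.continuousOn.mono subset_closure)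
        (fun x hx => hM x (subset_closure hx)) _
    have hu_int : Integrable (fun x => |u x| ^ q) (volume.restrict Ω) := by
      simpa [ENNReal.toReal_ofReal hq0.le] using
        hu_memLp.integrable_norm_rpow (by simpa using hq0) ENNReal.ofReal_ne_top
    have hsob : ∫ x in Ω, |u x| ^ q ≤ (C * (∫ x in Ω, ‖fderiv ℝ u x‖ ^ p) ^ (1 / p)) ^ q := by
      simpa [hp0.le, hq0.le] using integral_rpow_norm_le_of_eLpNorm_le (by simpa using hp0)
        (by simpa using hq0) hu_memLp (hderiv u hu) (hC u hu h0)
    have hA : 0 ≤ ∫ x in Ω, |u x| ^ p := integral_nonneg fun x => by positivity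
    have hB : 0 ≤ ∫ x in Ω, ‖fderiv ℝ u x‖ ^ p := integral_nonneg fun x => by positivity
    calc ∫ x in Ω, |u x| ^ α * |fderiv ℝ u x (Pi.single i 1)| ^ β
        ≤ ∫ x in Ω, (|u x| ^ q + ‖fderiv ℝ u x‖ ^ p) := by
          refine integral_mono_of_nonneg (ae_of_all _ fun x => by positivity)
            (hu_int.add (hderiv_int u hu)) (ae_of_all _ fun x => ?_)
          exact (mul_le_mul_of_nonneg_left (hpartial u x i) (by positivity)).trans
            (rpow_mul_rpow_le_rpow_add_rpow (abs_nonneg _) (norm_nonneg _) hβ0 hβp')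
      _ = (∫ x in Ω, |u x| ^ q) + ∫ x in Ω, ‖fderiv ℝ u x‖ ^ p :=
          integral_add hu_int (hderiv_int u hu)
      _ ≤ _ := by
          refine add_le_add (hsob.trans ?_) ((hgrad u).trans_eq (one_mul _).symm)
          rw [mul_rpow C.coe_nonneg (by positivity)]
          gcongr
          · exact le_add_of_nonneg_right zero_le_one
          · exact le_add_of_nonneg_left (by positivity)
end

section
/- Let Ω ⊂ ℝⁿ be a bounded domain with Lipschitz boundary, and suppose β > α ≥ 0, β ≥ 2 and α + β = n. Then for every q with 1 ≤ q < ∞ there exists a constant C = C(q, α, β, Ω) > 0 such that for all u ∈ C²(Ω̄) with u and ∇u vanishing on ∂Ω, ‖u‖_{L^q(Ω)} ≤ C [u]_{S̊₂}, where [u]_{S̊₂} := ( ∑_{i=1}^n ∫_Ω |u|^α |D_i² u|^β dx )^{1/(α+β)}. -/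
open MeasureTheory Real Set

lemma young_three {l₁ l₂ l₃ M δ : ℝ} (h₁ : 0 < l₁) (h₂ : 0 ≤ l₂) (h₃ : 0 ≤ l₃)
    (hs : l₁ + l₂ + l₃ = 1) (hM : 0 < M) (hδ : 0 < δ) :
    ∃ K : ℝ, 0 < K ∧ ∀ X Y Z : ℝ, 0 ≤ X → 0 ≤ Y → 0 ≤ Z →
      M * (X ^ l₁ * Y ^ l₂ * Z ^ l₃) ≤ K * X + δ * Y + δ * Z := by
  refine ⟨(M * δ ^ (-(l₂ + l₃))) ^ (1 / l₁), by positivity, fun X Y Z hX hY hZ => ?_⟩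
  set K := (M * δ ^ (-(l₂ + l₃))) ^ (1 / l₁) with hK
  have hK0 : 0 < K := by positivity
  have key := Real.geom_mean_le_arith_mean3_weighted h₁.le h₂ h₃
    (mul_nonneg hK0.le hX) (mul_nonneg hδ.le hY) (mul_nonneg hδ.le hZ) hs
  have hKl : K ^ l₁ * (δ ^ l₂ * δ ^ l₃) = M := by
    rw [hK, ← Real.rpow_mul (by positivity), one_div_mul_cancel h₁.ne', Real.rpow_one,
      ← Real.rpow_add hδ, mul_assoc, ← Real.rpow_add hδ]
    simp
  rw [Real.mul_rpow hK0.le hX, Real.mul_rpow hδ.le hY, Real.mul_rpow hδ.le hZ] at key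
  have h1 : l₁ * (K * X) ≤ K * X := mul_le_of_le_one_left (by positivity) (by linarith)
  have h2 : l₂ * (δ * Y) ≤ δ * Y := mul_le_of_le_one_left (by positivity) (by linarith)
  have h3 : l₃ * (δ * Z) ≤ δ * Z := mul_le_of_le_one_left (by positivity) (by linarith)
  calc M * (X ^ l₁ * Y ^ l₂ * Z ^ l₃)
      = K ^ l₁ * X ^ l₁ * (δ ^ l₂ * Y ^ l₂) * (δ ^ l₃ * Z ^ l₃) := by rw [← hKl]; ring
    _ ≤ _ := by linarith

lemma hasDerivAt_abs_pow_mul_self (m : ℕ) (s : ℝ) :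
    HasDerivAt (fun t : ℝ => |t| ^ m * t) ((m + 1) * |s| ^ m) s := by
  rcases eq_or_ne s 0 with rfl | hs
  · rcases Nat.eq_zero_or_pos m with rfl | hm
    · simpa using hasDerivAt_id' (0 : ℝ)
    · rw [hasDerivAt_iff_tendsto_slope]
      have : Filter.Tendsto (fun t : ℝ => |t| ^ m) (nhdsWithin 0 {0}ᶜ) (nhds (|0| ^ m)) :=
        ((continuous_abs.pow m).tendsto (0 : ℝ)).mono_left nhdsWithin_le_nhds
      rw [abs_zero, zero_pow hm.ne'] at *
      rw [mul_zero]
      refine this.congr' ?_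
      filter_upwards [self_mem_nhdsWithin] with t ht
      have : t ≠ 0 := ht
      simp [slope_def_field, this]
  · have h := ((hasDerivAt_abs hs).pow m).mul (hasDerivAt_id s)
    refine h.congr_deriv ?_
    rcases Nat.eq_zero_or_pos m with rfl | hm
    · simp
    · obtain ⟨k, rfl⟩ := Nat.exists_eq_add_of_lt hm
      rcases lt_or_gt_of_ne hs with h | h
      · simp [h, abs_of_neg h]; ring
      · simp [h, abs_of_pos h]; ring

/-- The derivative of the truncation `softCut ε`. -/
noncomputable def softCutDeriv (ε t : ℝ) : ℝ := 1 - ε ^ 2 / max (t ^ 2) (ε ^ 2)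

/-- A `C¹` truncation that vanishes on `[-ε, ε]` and tends to the identity as `ε → 0`. -/
noncomputable def softCut (ε s : ℝ) : ℝ := ∫ t in (0 : ℝ)..s, softCutDeriv ε t

lemma continuous_softCutDeriv {ε : ℝ} (hε : 0 < ε) : Continuous (softCutDeriv ε) := by
  unfold softCutDeriv
  refine continuous_const.sub (continuous_const.div (by fun_prop) fun t => ?_)
  exact (lt_max_of_lt_right (by positivity)).ne'

lemma softCutDeriv_nonneg {ε : ℝ} (hε : 0 < ε) (t : ℝ) : 0 ≤ softCutDeriv ε t := by
  unfold softCutDeriv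
  rw [sub_nonneg]
  exact div_le_one_of_le₀ (le_max_right _ _) (by positivity)

lemma softCutDeriv_le_one (ε t : ℝ) : softCutDeriv ε t ≤ 1 := by
  unfold softCutDeriv
  rw [sub_le_self_iff]
  positivity

lemma abs_softCutDeriv_le_one {ε : ℝ} (hε : 0 < ε) (t : ℝ) : |softCutDeriv ε t| ≤ 1 := by
  rw [abs_of_nonneg (softCutDeriv_nonneg hε t)]
  exact softCutDeriv_le_one ε t

lemma softCutDeriv_eq_zero {ε t : ℝ} (hε : 0 < ε) (ht : |t| ≤ ε) : softCutDeriv ε t = 0 := by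
  unfold softCutDeriv
  rw [max_eq_right (sq_le_sq' (neg_le_of_abs_le ht) (le_of_abs_le ht)), div_self (by positivity),
    sub_self]

lemma hasDerivAt_softCut {ε : ℝ} (hε : 0 < ε) (s : ℝ) :
    HasDerivAt (softCut ε) (softCutDeriv ε s) s :=
  (continuous_softCutDeriv hε).integral_hasStrictDerivAt 0 s |>.hasDerivAt

lemma contDiff_softCut {ε : ℝ} (hε : 0 < ε) : ContDiff ℝ 1 (softCut ε) := by
  rw [contDiff_one_iff_deriv]
  refine ⟨fun s => (hasDerivAt_softCut hε s).differentiableAt, ?_⟩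
  rw [show deriv (softCut ε) = softCutDeriv ε from funext fun s => (hasDerivAt_softCut hε s).deriv]
  exact continuous_softCutDeriv hε

lemma abs_softCut_le {ε : ℝ} (hε : 0 < ε) (s : ℝ) : |softCut ε s| ≤ |s| := by
  have := intervalIntegral.norm_integral_le_of_norm_le_const (f := softCutDeriv ε)
    (a := 0) (b := s) (C := 1) fun x _ => abs_softCutDeriv_le_one hε x
  simpa [softCut] using this

lemma softCut_eq_zero {ε s : ℝ} (hε : 0 < ε) (hs : |s| ≤ ε) : softCut ε s = 0 := by
  refine (intervalIntegral.integral_congr (g := fun _ => (0 : ℝ)) fun t ht => ?_).trans (by simp)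
  refine softCutDeriv_eq_zero hε ?_
  have := abs_sub_left_of_mem_uIcc ht
  simp only [sub_zero] at this
  exact this.trans hs

open Filter Topology in
lemma tendsto_softCutDeriv {ι : Type*} {l : Filter ι} {ε : ι → ℝ} (h : Tendsto ε l (𝓝 0))
    {t : ℝ} (ht : t ≠ 0) : Tendsto (fun k => softCutDeriv (ε k) t) l (𝓝 1) := by
  have : Tendsto (fun k => 1 - ε k ^ 2 / max (t ^ 2) (ε k ^ 2)) l
      (𝓝 (1 - 0 ^ 2 / max (t ^ 2) (0 ^ 2))) := by
    refine tendsto_const_nhds.sub ((h.pow 2).div (tendsto_const_nhds.max (h.pow 2)) ?_)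
    exact (lt_max_of_lt_left (by positivity)).ne'
  simpa [softCutDeriv] using this

open Filter Topology in
lemma tendsto_softCut {ι : Type*} {l : Filter ι} [l.IsCountablyGenerated] {ε : ι → ℝ}
    (hpos : ∀ k, 0 < ε k) (h : Tendsto ε l (𝓝 0)) (s : ℝ) :
    Tendsto (fun k => softCut (ε k) s) l (𝓝 s) := by
  have : Tendsto (fun k => softCut (ε k) s) l (𝓝 (∫ _ in (0 : ℝ)..s, (1 : ℝ))) := by
    refine intervalIntegral.tendsto_integral_filter_of_dominated_convergence (fun _ => 1)
      (Eventually.of_forall fun k => (continuous_softCutDeriv (hpos k)).aestronglyMeasurable)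
      (Eventually.of_forall fun k => Eventually.of_forall fun t _ =>
        abs_softCutDeriv_le_one (hpos k) t) (by simp) ?_
    have h0 : ∀ᵐ t : ℝ, t ≠ 0 := by simp [ae_iff]
    filter_upwards [h0] with t ht _ using tendsto_softCutDeriv h ht
  simpa using this

/-- A function is continuous and bounded on the set `U`. -/
def BoundedContinuousOn {X : Type*} [TopologicalSpace X] (f : X → ℝ) (U : Set X) : Prop :=
  ContinuousOn f U ∧ ∃ M, ∀ x ∈ U, |f x| ≤ M

namespace BoundedContinuousOn

variable {X : Type*} [TopologicalSpace X] {f g : X → ℝ} {U V : Set X}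

lemma mono (hf : BoundedContinuousOn f U) (h : V ⊆ U) : BoundedContinuousOn f V :=
  ⟨hf.1.mono h, hf.2.imp fun _ hM x hx => hM x (h hx)⟩

lemma comp {φ : ℝ → ℝ} (hφ : Continuous φ) (hf : BoundedContinuousOn f U) :
    BoundedContinuousOn (fun x => φ (f x)) U := by
  obtain ⟨M, hM⟩ := hf.2
  obtain ⟨B, hB⟩ := (isCompact_Icc (a := -M) (b := M)).exists_bound_of_continuousOn hφ.continuousOn
  exact ⟨hφ.comp_continuousOn hf.1, B, fun x hx => hB _ (abs_le.1 (hM x hx))⟩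

lemma mul (hf : BoundedContinuousOn f U) (hg : BoundedContinuousOn g U) :
    BoundedContinuousOn (fun x => f x * g x) U := by
  obtain ⟨M, hM⟩ := hf.2
  obtain ⟨N, hN⟩ := hg.2
  refine ⟨hf.1.mul hg.1, M * N, fun x hx => ?_⟩
  rw [abs_mul]
  exact mul_le_mul (hM x hx) (hN x hx) (abs_nonneg _) ((abs_nonneg _).trans (hM x hx))

lemma add (hf : BoundedContinuousOn f U) (hg : BoundedContinuousOn g U) :
    BoundedContinuousOn (fun x => f x + g x) U := by
  obtain ⟨M, hM⟩ := hf.2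
  obtain ⟨N, hN⟩ := hg.2
  exact ⟨hf.1.add hg.1, M + N, fun x hx => (abs_add_le _ _).trans (add_le_add (hM x hx) (hN x hx))⟩

lemma integrableOn [MeasurableSpace X] [OpensMeasurableSpace X] {μ : Measure X}
    (hf : BoundedContinuousOn f U) (hU : IsOpen U) (hfin : μ U ≠ ⊤) : IntegrableOn f U μ := by
  obtain ⟨M, hM⟩ := hf.2
  exact IntegrableOn.of_bound hfin.lt_top (hf.1.aestronglyMeasurable hU.measurableSet) M
    ((ae_restrict_iff' hU.measurableSet).2 (ae_of_all _ hM))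

end BoundedContinuousOn

section Truncation

open Filter Topology

lemma isCompact_superlevel {E : Type*} [NormedAddCommGroup E] [ProperSpace E] {U : Set E} (hU : IsOpen U)
    (hb : Bornology.IsBounded U) {u : E → ℝ} (hu : ContinuousOn u (closure U))
    (h0 : ∀ x ∈ frontier U, u x = 0) {ε : ℝ} (hε : 0 < ε) :
    ∃ K, IsCompact K ∧ K ⊆ U ∧ ∀ x ∈ U \ K, |u x| ≤ ε := by
  refine ⟨closure U ∩ u ⁻¹' {s | ε ≤ |s|}, ?_, fun x hx => ?_, fun x hx => ?_⟩
  · exact hb.isCompact_closure.of_isClosed_subset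
      (hu.preimage_isClosed_of_isClosed isClosed_closure
        (isClosed_le continuous_const continuous_abs)) inter_subset_left
  · by_contra hxU
    have : x ∈ frontier U := by rw [hU.frontier_eq]; exact ⟨hx.1, hxU⟩
    have h2 : ε ≤ |u x| := hx.2
    rw [h0 x this, abs_zero] at h2
    linarith
  · by_contra! h
    exact hx.2 ⟨subset_closure hx.1, h.le⟩

variable {E : Type*} [NormedAddCommGroup E] [NormedSpace ℝ E] [FiniteDimensional ℝ E]
  [MeasurableSpace E] [BorelSpace E] {μ : Measure E}

/-- The integral of a directional derivative vanishes for functions supported in a compact subset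
of an open set. -/
lemma setIntegral_lineDeriv_eq_zero [μ.IsAddHaarMeasure] {U K : Set E} (hU : IsOpen U)
    (hK : IsCompact K) (hKU : K ⊆ U) {f f' : E → ℝ} {e : E} (hf : ContinuousOn f U)
    (hf' : ContinuousOn f' U) (hd : ∀ x ∈ U, HasLineDerivAt ℝ f (f' x) x e)
    (h0 : ∀ x ∈ U \ K, f x = 0) : ∫ x in U, f' x ∂μ = 0 := by
  have hUK : IsOpen (U \ K) := hU.sdiff hK.isClosed
  have h0' : ∀ x ∈ U \ K, f' x = 0 := fun x hx => by
    have : HasLineDerivAt ℝ f 0 x e :=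
      ((hasFDerivAt_const (0 : ℝ) x).hasLineDerivAt e).congr_of_eventuallyEq
        (by filter_upwards [hUK.mem_nhds hx] with y hy using h0 y hy)
    exact (hd x hx.1).unique this
  have ext : ∀ g : E → ℝ, (∀ x ∈ U \ K, g x = 0) → U.indicator g = K.indicator g := fun g hg => by
    ext x
    by_cases hxK : x ∈ K
    · simp [hxK, hKU hxK]
    · by_cases hxU : x ∈ U
      · simp [hxK, hxU, hg x ⟨hxU, hxK⟩]
      · simp [hxK, hxU]
  have hdi : ∀ x, HasLineDerivAt ℝ (U.indicator f) (U.indicator f' x) x e := fun x => by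
    by_cases hxU : x ∈ U
    · rw [indicator_of_mem hxU]
      refine (hd x hxU).congr_of_eventuallyEq ?_
      filter_upwards [hU.mem_nhds hxU] with y hy using indicator_of_mem hy f
    · have hxK : x ∉ K := fun h => hxU (hKU h)
      rw [indicator_of_notMem hxU, ext f h0]
      refine ((hasFDerivAt_const (0 : ℝ) x).hasLineDerivAt e).congr_of_eventuallyEq ?_
      filter_upwards [hK.isClosed.isOpen_compl.mem_nhds hxK] with y hy
        using indicator_of_notMem hy f
  have hint : ∀ g : E → ℝ, ContinuousOn g U → (∀ x ∈ U \ K, g x = 0) →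
      Integrable (U.indicator g) μ := fun g hg hg0 => by
    rw [ext g hg0, integrable_indicator_iff hK.measurableSet]
    exact (hg.mono hKU).integrableOn_compact hK
  have key := integral_bilinear_hasLineDerivAt_right_eq_neg_left_of_integrable (μ := μ)
    (f := fun _ => (1 : ℝ)) (f' := fun _ => 0) (g := U.indicator f) (g' := U.indicator f') (v := e)
    (B := ContinuousLinearMap.mul ℝ ℝ) (by simp) (by simpa using hint f' hf' h0')
    (by simpa using hint f hf h0)
    (fun x _ => (hasFDerivAt_const (1 : ℝ) x).hasLineDerivAt e) (fun x _ => hdi x)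
  simpa [integral_indicator hU.measurableSet] using key

/-- If `u` vanishes on the boundary of `U`, then `∫_U ∂ₑ(u g) = 0`, without boundary conditions
on `g`. -/
lemma setIntegral_mul_add_mul_eq_zero [μ.IsAddHaarMeasure] {U : Set E} (hU : IsOpen U)
    (hb : Bornology.IsBounded U) {u v g g' : E → ℝ} {e : E} (hu : ContinuousOn u (closure U))
    (h0 : ∀ x ∈ frontier U, u x = 0) (hne : ∀ x ∈ U, u x ≠ 0)
    (hv : BoundedContinuousOn v U) (hg : BoundedContinuousOn g U) (hg' : BoundedContinuousOn g' U)
    (hdu : ∀ x ∈ U, HasLineDerivAt ℝ u (v x) x e) (hdg : ∀ x ∈ U, HasLineDerivAt ℝ g (g' x) x e) :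
    ∫ x in U, (v x * g x + u x * g' x) ∂μ = 0 := by
  have := FiniteDimensional.proper_real E
  obtain ⟨hv, Mv, hvM⟩ := hv
  obtain ⟨hg, Mg, hgM⟩ := hg
  obtain ⟨hg', Mg', hg'M⟩ := hg'
  have huU : ContinuousOn u U := hu.mono subset_closure
  obtain ⟨B, hB⟩ : ∃ B, ∀ x ∈ closure U, |u x| ≤ B :=
    hb.isCompact_closure.exists_bound_of_continuousOn hu
  set ε : ℕ → ℝ := fun k => 1 / ((k : ℝ) + 1) with hε
  have hpos : ∀ k, 0 < ε k := fun k => by positivity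
  have hlim : Tendsto ε atTop (𝓝 0) := tendsto_one_div_add_atTop_nhds_zero_nat
  have hdc : ∀ k, ContinuousOn (fun x => softCutDeriv (ε k) (u x)) U := fun k =>
    (continuous_softCutDeriv (hpos k)).comp_continuousOn huU
  have hcc : ∀ k, ContinuousOn (fun x => softCut (ε k) (u x)) U := fun k =>
    (contDiff_softCut (hpos k)).continuous.comp_continuousOn huU
  have hcont : ∀ k, ContinuousOn (fun x => softCutDeriv (ε k) (u x) * v x * g x +
      softCut (ε k) (u x) * g' x) U := fun k =>
    (((hdc k).mul hv).mul hg).add ((hcc k).mul hg')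
  have hz : ∀ k, ∫ x in U, (softCutDeriv (ε k) (u x) * v x * g x +
      softCut (ε k) (u x) * g' x) ∂μ = 0 := fun k => by
    obtain ⟨K, hK, hKU, hKu⟩ := isCompact_superlevel hU hb hu h0 (hpos k)
    refine setIntegral_lineDeriv_eq_zero (f := fun x => softCut (ε k) (u x) * g x) (e := e) hU hK hKU
      ((hcc k).mul hg) (hcont k) (fun x hx => ?_)
      (fun x hx => by simp [softCut_eq_zero (hpos k) (hKu x hx)])
    have h1 := hdu x hx
    have h2 := hdg x hx
    unfold HasLineDerivAt at h1 h2 ⊢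
    have h3 : HasDerivAt (softCut (ε k)) (softCutDeriv (ε k) (u x)) (u (x + (0 : ℝ) • e)) := by
      simpa using hasDerivAt_softCut (hpos k) (u x)
    have h4 := (h3.comp (0 : ℝ) h1).mul h2
    simpa [Function.comp_def, Pi.mul_def] using h4
  have hT := tendsto_integral_of_dominated_convergence (μ := μ.restrict U) (fun _ => Mv * Mg + B * Mg')
    (F := fun k x => softCutDeriv (ε k) (u x) * v x * g x + softCut (ε k) (u x) * g' x)
    (f := fun x => v x * g x + u x * g' x)
    (fun k => (hcont k).aestronglyMeasurable hU.measurableSet)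
    (by
      have : μ U ≠ ⊤ := hb.measure_lt_top.ne
      simp [isFiniteMeasure_restrict, this])
    (fun k => (ae_restrict_iff' hU.measurableSet).2 (ae_of_all _ fun x hx => by
      have hMv : 0 ≤ Mv := (abs_nonneg _).trans (hvM x hx)
      have hb1 := abs_softCutDeriv_le_one (hpos k) (u x)
      have hb2 := (abs_softCut_le (hpos k) (u x)).trans (hB x (subset_closure hx))
      rw [Real.norm_eq_abs]
      refine (abs_add_le _ _).trans ?_
      rw [abs_mul, abs_mul, abs_mul]
      have h1 : |softCutDeriv (ε k) (u x)| * |v x| ≤ Mv :=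
        (mul_le_of_le_one_left (abs_nonneg _) hb1).trans (hvM x hx)
      have hB0 : 0 ≤ B := (abs_nonneg _).trans hb2
      exact add_le_add (mul_le_mul h1 (hgM x hx) (abs_nonneg _) hMv)
        (mul_le_mul hb2 (hg'M x hx) (abs_nonneg _) hB0)))
    ((ae_restrict_iff' hU.measurableSet).2 (ae_of_all _ fun x hx => by
      have h1 := ((tendsto_softCutDeriv hlim (hne x hx)).mul_const (v x)).mul_const (g x)
      have h2 := (tendsto_softCut hpos hlim (u x)).mul_const (g' x)
      simpa using h1.add h2))
  simp only [hz] at hT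
  exact (tendsto_nhds_unique hT tendsto_const_nhds)

end Truncation

section Estimates

variable {E : Type*} [NormedAddCommGroup E] [NormedSpace ℝ E] [FiniteDimensional ℝ E]
  [MeasurableSpace E] [BorelSpace E]

/-- Poincaré's inequality in a single direction `e`. -/
lemma exists_setIntegral_abs_pow_le (μ : Measure E) [μ.IsAddHaarMeasure] (m : ℕ) {R : ℝ} (hR : 0 < R)
    {e : E} {l : E →L[ℝ] ℝ} (hl : l e = 1) :
    ∃ K : ℝ, 0 < K ∧ ∀ U : Set E, IsOpen U → Bornology.IsBounded U → (∀ x ∈ U, |l x| ≤ R) →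
      ∀ u v : E → ℝ, ContinuousOn u (closure U) → (∀ x ∈ frontier U, u x = 0) →
        (∀ x ∈ U, u x ≠ 0) → BoundedContinuousOn v U →
        (∀ x ∈ U, HasLineDerivAt ℝ u (v x) x e) →
        ∫ x in U, |u x| ^ (m + 2) ∂μ ≤ K * ∫ x in U, |v x| ^ (m + 2) ∂μ := by
  have := FiniteDimensional.proper_real E
  have hm : (0 : ℝ) < (m : ℝ) + 2 := by positivity
  obtain ⟨K, hK, hKy⟩ := young_three (l₁ := 1 / (m + 2)) (l₂ := (m + 1) / (m + 2)) (l₃ := 0)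
    (M := (m + 2) * R) (δ := 1 / 2) (by positivity) (by positivity) le_rfl
    (by field_simp; ring) (by positivity) (by norm_num)
  refine ⟨2 * K, by positivity, fun U hU hb hRU u v hu h0 hne hv hdu => ?_⟩
  have hfin : μ U ≠ ⊤ := hb.measure_lt_top.ne
  have hub : BoundedContinuousOn u U :=
    ⟨hu.mono subset_closure, (hb.isCompact_closure.exists_bound_of_continuousOn hu).imp
      fun _ h x hx => h x (subset_closure hx)⟩
  have hlb : BoundedContinuousOn (fun x => l x) U := ⟨l.continuous.continuousOn, R, hRU⟩
  have hpu : BoundedContinuousOn (fun x => |u x| ^ m * u x) U :=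
    hub.comp (φ := fun s => |s| ^ m * s) (by fun_prop)
  have hdpu : BoundedContinuousOn (fun x => (m + 1) * |u x| ^ m) U :=
    hub.comp (φ := fun s => (m + 1) * |s| ^ m) (by fun_prop)
  have hg' : BoundedContinuousOn
      (fun x => |u x| ^ m * u x + l x * ((m + 1) * |u x| ^ m * v x)) U :=
    hpu.add (hlb.mul (hdpu.mul hv))
  have hz := setIntegral_mul_add_mul_eq_zero (μ := μ) hU hb hu h0 hne hv (hlb.mul hpu) hg' hdu
    fun x hx => by
      have h1 := hdu x hx
      have h2 : HasLineDerivAt ℝ l (l e) x e := l.hasFDerivAt.hasLineDerivAt e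
      unfold HasLineDerivAt at h1 h2 ⊢
      have h3 := hasDerivAt_abs_pow_mul_self m (u (x + (0 : ℝ) • e))
      have h4 := h2.mul (h3.comp (0 : ℝ) h1)
      simpa [Function.comp_def, Pi.mul_def, hl] using h4
  have hIu := (hub.comp (φ := fun s => |s| ^ (m + 2)) (by fun_prop)).integrableOn (μ := μ) hU hfin
  have hIv := (hv.comp (φ := fun s => |s| ^ (m + 2)) (by fun_prop)).integrableOn (μ := μ) hU hfin
  have hIz := ((hv.mul (hlb.mul hpu)).add (hub.mul hg')).integrableOn (μ := μ) hU hfin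
  have hle := setIntegral_mono_on (μ := μ) hIu ((hIz.add (hIv.const_mul K)).add (hIu.const_mul (1 / 2)))
    hU.measurableSet fun x hx => by
      have hy := hKy (|v x| ^ (m + 2)) (|u x| ^ (m + 2)) 0 (by positivity) (by positivity) le_rfl
      have e1 : (|v x| ^ (m + 2)) ^ (1 / ((m : ℝ) + 2)) = |v x| := by
        rw [← Real.rpow_natCast, ← Real.rpow_mul (abs_nonneg _)]
        push_cast
        rw [mul_one_div_cancel hm.ne', Real.rpow_one]
      have e2 : (|u x| ^ (m + 2)) ^ (((m : ℝ) + 1) / ((m : ℝ) + 2)) = |u x| ^ (m + 1) := by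
        rw [← Real.rpow_natCast, ← Real.rpow_mul (abs_nonneg _)]
        push_cast
        rw [mul_div_cancel₀ _ hm.ne', ← Real.rpow_natCast]
        push_cast
        rfl
      rw [e1, e2, Real.rpow_zero, mul_one, mul_zero, add_zero] at hy
      have h1 : v x * (l x * (|u x| ^ m * u x)) +
          u x * (|u x| ^ m * u x + l x * ((m + 1) * |u x| ^ m * v x)) =
          |u x| ^ (m + 2) + (m + 2) * (l x * (|u x| ^ m * u x * v x)) := by
        rw [pow_add, sq_abs]; ring
      have h2 : |l x * (|u x| ^ m * u x * v x)| ≤ R * (|v x| * |u x| ^ (m + 1)) := by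
        rw [abs_mul, abs_mul, abs_mul, abs_pow, abs_abs, ← pow_succ, mul_comm (|u x| ^ (m + 1))]
        exact mul_le_mul_of_nonneg_right (hRU x hx) (by positivity)
      have h3 := mul_le_mul_of_nonneg_left (neg_le_of_abs_le h2) hm.le
      simp only [Pi.add_apply]
      rw [h1]
      linarith
  rw [integral_add' (hIz.add (hIv.const_mul K)) (hIu.const_mul _), integral_add' hIz (hIv.const_mul K),
    integral_const_mul, integral_const_mul, hz] at hle
  linarith

lemma mul_mul_eq_rpow_mul_rpow {m : ℕ} {α β : ℝ} (hβ : 0 < β) {a b c : ℝ} (ha : 0 < a) (hb : 0 ≤ b)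
    (hc : 0 ≤ c) :
    (a ^ α * c ^ β) ^ (1 / β) * (a ^ (m + 2)) ^ ((1 - α / β) / (m + 2)) *
      (b ^ (m + 2)) ^ ((m : ℝ) / (m + 2)) = a * c * b ^ m := by
  have hm : (m : ℝ) + 2 ≠ 0 := by positivity
  rw [Real.mul_rpow (by positivity) (by positivity), ← Real.rpow_mul ha.le, ← Real.rpow_mul hc,
    ← Real.rpow_natCast, ← Real.rpow_natCast, ← Real.rpow_mul ha.le, ← Real.rpow_mul hb]
  push_cast
  rw [mul_div_cancel₀ _ hm, mul_div_cancel₀ _ hm, mul_one_div_cancel hβ.ne', Real.rpow_one,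
    Real.rpow_natCast, mul_one_div, mul_right_comm (a ^ (α / β)), ← Real.rpow_add ha]
  simp

/-- The weighted second derivative controls the first derivative, in a single direction `e`. -/
lemma exists_setIntegral_abs_deriv_pow_le (μ : Measure E) [μ.IsAddHaarMeasure] (m : ℕ) {α β : ℝ}
    (hα : 0 ≤ α) (hαβ : α ≤ β) (hβ : 0 < β) (hs : α + β = m + 2) {P : ℝ} (hP : 0 < P) :
    ∃ K : ℝ, 0 < K ∧ ∀ U : Set E, IsOpen U → Bornology.IsBounded U →
      ∀ (e : E) (u v w : E → ℝ), ContinuousOn u (closure U) → (∀ x ∈ frontier U, u x = 0) →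
        (∀ x ∈ U, u x ≠ 0) → BoundedContinuousOn v U → BoundedContinuousOn w U →
        (∀ x ∈ U, HasLineDerivAt ℝ u (v x) x e) → (∀ x ∈ U, HasLineDerivAt ℝ v (w x) x e) →
        ∫ x in U, |u x| ^ (m + 2) ∂μ ≤ P * ∫ x in U, |v x| ^ (m + 2) ∂μ →
        ∫ x in U, |v x| ^ (m + 2) ∂μ ≤ K * ∫ x in U, |u x| ^ α * |w x| ^ β ∂μ := by
  have := FiniteDimensional.proper_real E
  set δ : ℝ := 1 / (2 * (P + 1)) with hδ
  have hδ0 : 0 < δ := by positivity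
  obtain ⟨K, hK, hKy⟩ := young_three (l₁ := 1 / β) (l₂ := (1 - α / β) / (m + 2))
    (l₃ := (m : ℝ) / (m + 2)) (M := (m : ℝ) + 1) (δ := δ) (by positivity)
    (div_nonneg (sub_nonneg.2 ((div_le_one hβ).2 hαβ)) (by positivity)) (by positivity)
    (by
      have : (m : ℝ) + 2 ≠ 0 := by positivity
      have hm : (m : ℝ) = α + β - 2 := by linarith
      field_simp
      rw [hm]; ring)
    (by positivity) hδ0
  refine ⟨2 * K, by positivity, fun U hU hb e u v w hu h0 hne hv hw hdu hdv hPu => ?_⟩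
  have hfin : μ U ≠ ⊤ := hb.measure_lt_top.ne
  have hub : BoundedContinuousOn u U :=
    ⟨hu.mono subset_closure, (hb.isCompact_closure.exists_bound_of_continuousOn hu).imp
      fun _ h x hx => h x (subset_closure hx)⟩
  have hpv : BoundedContinuousOn (fun x => |v x| ^ m * v x) U :=
    hv.comp (φ := fun s => |s| ^ m * s) (by fun_prop)
  have hdpv : BoundedContinuousOn (fun x => (m + 1) * |v x| ^ m * w x) U :=
    (hv.comp (φ := fun s => (m + 1) * |s| ^ m) (by fun_prop)).mul hw
  have hz := setIntegral_mul_add_mul_eq_zero (μ := μ) hU hb hu h0 hne hv hpv hdpv hdu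
    fun x hx => by
      have h1 := hdv x hx
      unfold HasLineDerivAt at h1 ⊢
      have h3 := hasDerivAt_abs_pow_mul_self m (v (x + (0 : ℝ) • e))
      simpa [Function.comp_def] using h3.comp (0 : ℝ) h1
  have hIu := (hub.comp (φ := fun s => |s| ^ (m + 2)) (by fun_prop)).integrableOn (μ := μ) hU hfin
  have hIv := (hv.comp (φ := fun s => |s| ^ (m + 2)) (by fun_prop)).integrableOn (μ := μ) hU hfin
  have hIz := ((hv.mul hpv).add (hub.mul hdpv)).integrableOn (μ := μ) hU hfin
  have hIw := ((hub.comp (φ := fun s => |s| ^ α) (continuous_abs.rpow_const fun _ => Or.inr hα)).mul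
    (hw.comp (φ := fun s => |s| ^ β)
      (continuous_abs.rpow_const fun _ => Or.inr hβ.le))).integrableOn (μ := μ) hU hfin
  have hle := setIntegral_mono_on (μ := μ) hIv
    (((hIz.add (hIw.const_mul K)).add (hIu.const_mul δ)).add (hIv.const_mul δ))
    hU.measurableSet fun x hx => by
      have hy := hKy (|u x| ^ α * |w x| ^ β) (|u x| ^ (m + 2)) (|v x| ^ (m + 2)) (by positivity)
        (by positivity) (by positivity)
      rw [mul_mul_eq_rpow_mul_rpow hβ (abs_pos.2 (hne x hx)) (abs_nonneg _) (abs_nonneg _)] at hy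
      have h1 : v x * (|v x| ^ m * v x) + u x * ((m + 1) * |v x| ^ m * w x) =
          |v x| ^ (m + 2) + (m + 1) * (u x * w x * |v x| ^ m) := by
        rw [pow_add, sq_abs]; ring
      have h2 : |u x * w x * |v x| ^ m| ≤ |u x| * |w x| * |v x| ^ m := by
        rw [abs_mul, abs_mul, abs_pow, abs_abs]
      have h3 := mul_le_mul_of_nonneg_left (neg_le_of_abs_le h2) (by positivity : 0 ≤ (m : ℝ) + 1)
      simp only [Pi.add_apply]
      rw [h1]
      linarith
  rw [integral_add' ((hIz.add (hIw.const_mul K)).add (hIu.const_mul δ)) (hIv.const_mul _),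
    integral_add' (hIz.add (hIw.const_mul K)) (hIu.const_mul _), integral_add' hIz (hIw.const_mul K),
    integral_const_mul, integral_const_mul, integral_const_mul, hz] at hle
  have h1 := mul_le_mul_of_nonneg_left hPu hδ0.le
  have h2 : δ * (P + 1) = 1 / 2 := by rw [hδ]; field_simp
  have h3 : δ * (P * ∫ x in U, |v x| ^ (m + 2) ∂μ) + δ * ∫ x in U, |v x| ^ (m + 2) ∂μ =
      1 / 2 * ∫ x in U, |v x| ^ (m + 2) ∂μ := by rw [← h2]; ring
  linarith

end Estimates

open scoped NNReal ENNReal in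
/-- The critical Sobolev inequality on bounded sets, for exponents `m + 2 = dim E` and `q < ∞`. -/
lemma exists_setIntegral_rpow_le_setIntegral_fderiv {E : Type*} [NormedAddCommGroup E]
    [NormedSpace ℝ E] [FiniteDimensional ℝ E] [MeasurableSpace E] [BorelSpace E] (μ : Measure E)
    [μ.IsAddHaarMeasure] {m : ℕ} (hm : Module.finrank ℝ E = m + 2) {Ω : Set E}
    (hb : Bornology.IsBounded Ω) {q : ℝ} (hq : 0 < q) :
    ∃ C : ℝ, 0 ≤ C ∧ ∀ w : E → ℝ, ContDiff ℝ 1 w → HasCompactSupport w → tsupport w ⊆ Ω →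
      (∫ x in Ω, |w x| ^ q ∂μ) ^ (1 / q) ≤
        C * (∫ x in Ω, ‖fderiv ℝ w x‖ ^ (m + 2) ∂μ) ^ (1 / ((m : ℝ) + 2)) := by
  set p : ℝ≥0 := max 1 ((1 / ((m : ℝ≥0) + 2) + 1 / q.toNNReal)⁻¹) with hp
  have hq' : 0 < q.toNNReal := Real.toNNReal_pos.2 hq
  have hp1 : 1 ≤ p := le_max_left _ _
  have hpn : p < (m : ℝ≥0) + 2 := by
    refine max_lt ?_ ?_
    · have : (0 : ℝ≥0) ≤ m := zero_le
      exact lt_of_lt_of_le one_lt_two (le_add_of_nonneg_left this)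
    · rw [inv_lt_comm₀ (by positivity) (by positivity), ← one_div]
      exact lt_add_of_pos_right _ (by positivity)
  have hpq : (p : ℝ)⁻¹ - ((m : ℝ) + 2)⁻¹ ≤ ((q.toNNReal : ℝ≥0) : ℝ)⁻¹ := by
    have h1 : p⁻¹ ≤ 1 / ((m : ℝ≥0) + 2) + 1 / q.toNNReal :=
      inv_le_of_inv_le₀ (by positivity) (le_max_right _ _)
    have h2 : (p : ℝ)⁻¹ ≤ 1 / ((m : ℝ) + 2) + 1 / (q.toNNReal : ℝ) := by exact_mod_cast h1
    rw [one_div, one_div] at h2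
    linarith
  set N : ℝ≥0 := (m : ℝ≥0) + 2 with hN
  have hNR : (N : ℝ) = m + 2 := by simp [hN]
  set V : ℝ≥0∞ := μ Ω ^ (1 / (p : ℝ) - 1 / (N : ℝ)) with hV
  have hVtop : V ≠ ⊤ := ENNReal.rpow_ne_top_of_nonneg
    (sub_nonneg.2 (one_div_le_one_div_of_le (by positivity) (by exact_mod_cast hpn.le)))
    hb.measure_lt_top.ne
  obtain ⟨S, hS⟩ : ∃ S : ℝ≥0, S = eLpNormLESNormFDerivOfLeConst ℝ μ Ω p q.toNNReal := ⟨_, rfl⟩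
  refine ⟨S * V.toReal, mul_nonneg S.coe_nonneg ENNReal.toReal_nonneg, fun w hw hwc hwΩ => ?_⟩
  have hdc : HasCompactSupport (fderiv ℝ w) := hwc.fderiv (𝕜 := ℝ)
  have hcont : Continuous (fderiv ℝ w) := hw.continuous_fderiv one_ne_zero
  have hsob : eLpNorm w q.toNNReal μ ≤ S * eLpNorm (fderiv ℝ w) p μ := by
    rw [hS]
    exact eLpNorm_le_eLpNorm_fderiv_of_le μ hw ((subset_tsupport w).trans hwΩ) hp1
      (by rw [hm]; push_cast; exact hpn) (by rw [hm]; push_cast; exact hpq) hb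
  have hdsupp : Function.support (fun x => ‖fderiv ℝ w x‖) ⊆ Ω := by
    rw [Function.support_subset_iff']
    intro x hx
    rw [image_eq_zero_of_notMem_tsupport
      fun h => hx (hwΩ (tsupport_fderiv_subset ℝ h)), norm_zero]
  have hrestr : eLpNorm (fderiv ℝ w) p μ = eLpNorm (fderiv ℝ w) p (μ.restrict Ω) := by
    rw [← eLpNorm_norm (fderiv ℝ w), ← eLpNorm_norm (fderiv ℝ w),
      eLpNorm_restrict_eq_of_support_subset hdsupp]
  have hhol : eLpNorm (fderiv ℝ w) p (μ.restrict Ω) ≤ eLpNorm (fderiv ℝ w) N (μ.restrict Ω) * V := by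
    have := eLpNorm_le_eLpNorm_mul_rpow_measure_univ (μ := μ.restrict Ω) (p := p) (q := N)
      (by exact_mod_cast hpn.le) hcont.aestronglyMeasurable
    simpa [hV] using this
  have hfin : eLpNorm (fderiv ℝ w) N (μ.restrict Ω) ≠ ⊤ :=
    ((hcont.memLp_of_hasCompactSupport hdc).restrict Ω).eLpNorm_ne_top
  have hall : eLpNorm w q.toNNReal (μ.restrict Ω) ≤
      S * (eLpNorm (fderiv ℝ w) N (μ.restrict Ω) * V) :=
    (eLpNorm_mono_measure _ Measure.restrict_le_self).trans
      (hsob.trans (by rw [hrestr]; gcongr))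
  have hreal := ENNReal.toReal_mono (ENNReal.mul_ne_top ENNReal.coe_ne_top
    (ENNReal.mul_ne_top hfin hVtop)) hall
  rw [ENNReal.toReal_mul, ENNReal.toReal_mul, toReal_eLpNorm hw.continuous.aestronglyMeasurable,
    toReal_eLpNorm hcont.aestronglyMeasurable,
    lpNorm_nnreal_eq_integral_norm_rpow hq'.ne' hw.continuous.aestronglyMeasurable,
    lpNorm_nnreal_eq_integral_norm_rpow (by positivity) hcont.aestronglyMeasurable,
    Real.coe_toNNReal q hq.le, hNR] at hreal
  have hpow : ∀ x, ‖fderiv ℝ w x‖ ^ ((m : ℝ) + 2) = ‖fderiv ℝ w x‖ ^ (m + 2) := fun x => by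
    rw [← Real.rpow_natCast]; push_cast; rfl
  simp only [hpow, Real.norm_eq_abs, ENNReal.coe_toReal] at hreal
  rw [one_div, one_div]
  linarith

open Filter Topology in
/-- A function of class `C²` up to the boundary of a bounded open set has bounded first and second
derivatives. -/
lemma exists_bound_fderiv_fderiv {E : Type*} [NormedAddCommGroup E] [NormedSpace ℝ E] [ProperSpace E]
    {Ω : Set E} (hΩ : IsOpen Ω) (hb : Bornology.IsBounded Ω) {u : E → ℝ}
    (hu : ContDiffOn ℝ 2 u (closure Ω)) :
    ∃ M, ∀ x ∈ Ω, ‖fderiv ℝ u x‖ ≤ M ∧ ‖fderiv ℝ (fderiv ℝ u) x‖ ≤ M := by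
  suffices h : ∃ M, ∀ x ∈ closure Ω, x ∈ Ω →
      ‖fderiv ℝ u x‖ ≤ M ∧ ‖fderiv ℝ (fderiv ℝ u) x‖ ≤ M from
    h.imp fun M hM x hx => hM x (subset_closure hx) hx
  refine hb.isCompact_closure.induction_on
    (p := fun s => ∃ M, ∀ x ∈ s, x ∈ Ω → ‖fderiv ℝ u x‖ ≤ M ∧ ‖fderiv ℝ (fderiv ℝ u) x‖ ≤ M)
    ⟨0, by simp⟩ (fun s t hst ⟨M, hM⟩ => ⟨M, fun x hx => hM x (hst hx)⟩)
    (fun s t ⟨M, hM⟩ ⟨N, hN⟩ => ⟨max M N, fun x hx hxΩ => ?_⟩) fun x hx => ?_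
  · rcases hx with hx | hx
    · exact ⟨(hM x hx hxΩ).1.trans (le_max_left _ _), (hM x hx hxΩ).2.trans (le_max_left _ _)⟩
    · exact ⟨(hN x hx hxΩ).1.trans (le_max_right _ _), (hN x hx hxΩ).2.trans (le_max_right _ _)⟩
  · have h2 : ContDiffWithinAt ℝ (1 + 1) u (closure Ω) x := by
      rw [one_add_one_eq_two]; exact hu x hx
    obtain ⟨t, ht, -, -, f', hf', hf'1⟩ :=
      (contDiffWithinAt_succ_iff_hasFDerivWithinAt' (by simp)).1 h2
    have h1 : ContDiffWithinAt ℝ (0 + 1) f' (closure Ω) x := by rwa [zero_add]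
    obtain ⟨t', ht', -, -, f'', hf'', hf''0⟩ :=
      (contDiffWithinAt_succ_iff_hasFDerivWithinAt' (by simp)).1 h1
    rw [insert_eq_of_mem hx] at ht ht'
    obtain ⟨O, hO, hxO, hOt⟩ := mem_nhdsWithin.1 (inter_mem ht ht')
    have hc' := hf'1.continuousWithinAt.norm.eventually (gt_mem_nhds (lt_add_one ‖f' x‖))
    have hc'' := hf''0.continuousWithinAt.norm.eventually (gt_mem_nhds (lt_add_one ‖f'' x‖))
    refine ⟨_, inter_mem (inter_mem hc' hc'') (mem_nhdsWithin_of_mem_nhds (hO.mem_nhds hxO)),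
      max (‖f' x‖ + 1) (‖f'' x‖ + 1), fun y hy hyΩ => ?_⟩
    have hnhds : ∀ z ∈ Ω, closure Ω ∈ 𝓝 z := fun z hz =>
      mem_of_superset (hΩ.mem_nhds hz) subset_closure
    have hfd : ∀ z ∈ O ∩ Ω, fderiv ℝ u z = f' z := fun z hz =>
      ((hf' z (hOt ⟨hz.1, subset_closure hz.2⟩).1).hasFDerivAt (hnhds z hz.2)).fderiv
    have hev : fderiv ℝ u =ᶠ[𝓝 y] f' := by
      filter_upwards [(hO.inter hΩ).mem_nhds ⟨hy.2, hyΩ⟩] with z hz using hfd z hz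
    have hfdd : fderiv ℝ (fderiv ℝ u) y = f'' y := by
      rw [hev.fderiv_eq]
      exact ((hf'' y (hOt ⟨hy.2, subset_closure hyΩ⟩).2).hasFDerivAt (hnhds y hyΩ)).fderiv
    rw [hfd y ⟨hy.2, hyΩ⟩, hfdd]
    exact ⟨(le_of_lt hy.1.1).trans (le_max_left _ _), (le_of_lt hy.1.2).trans (le_max_right _ _)⟩

lemma norm_le_sum_abs_apply_single {n : ℕ} (L : (Fin n → ℝ) →L[ℝ] ℝ) :
    ‖L‖ ≤ ∑ i, |L (Pi.single i 1)| := by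
  refine L.opNorm_le_bound (Finset.sum_nonneg fun i _ => abs_nonneg _) fun x => ?_
  have : L x = ∑ i, x i * L (Pi.single i 1) := by
    conv_lhs => rw [pi_eq_sum_univ' x, map_sum]
    simp
  rw [this, Finset.sum_mul, Real.norm_eq_abs]
  refine (Finset.abs_sum_le_sum_abs _ _).trans (Finset.sum_le_sum fun i _ => ?_)
  rw [abs_mul, mul_comm]
  exact mul_le_mul_of_nonneg_left (norm_le_pi_norm x i) (abs_nonneg _)

open Filter Topology in
lemma exists_contDiff_truncation {E : Type*} [NormedAddCommGroup E] [NormedSpace ℝ E] [ProperSpace E]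
    {U : Set E} (hU : IsOpen U) (hb : Bornology.IsBounded U) {u : E → ℝ}
    (hu : ContinuousOn u (closure U)) (h0 : ∀ x ∈ frontier U, u x = 0) (hu1 : ContDiffOn ℝ 1 u U)
    {ε : ℝ} (hε : 0 < ε) :
    ∃ w : E → ℝ, ContDiff ℝ 1 w ∧ HasCompactSupport w ∧ tsupport w ⊆ U ∧
      (∀ x ∈ U, w x = softCut ε (u x)) ∧ ∀ x ∈ U, ‖fderiv ℝ w x‖ ≤ ‖fderiv ℝ u x‖ := by
  obtain ⟨K, hK, hKU, hKu⟩ := isCompact_superlevel hU hb hu h0 hε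
  set w : E → ℝ := U.indicator fun x => softCut ε (u x) with hw
  have hwK : ∀ x ∉ K, w x = 0 := fun x hx => by
    by_cases hxU : x ∈ U
    · rw [hw, indicator_of_mem hxU, softCut_eq_zero hε (hKu x ⟨hxU, hx⟩)]
    · rw [hw, indicator_of_notMem hxU]
  have hsupp : tsupport w ⊆ K :=
    closure_minimal (Function.support_subset_iff'.2 hwK) hK.isClosed
  have hev : ∀ x ∈ U, w =ᶠ[𝓝 x] softCut ε ∘ u := fun x hx => by
    filter_upwards [hU.mem_nhds hx] with y hy using indicator_of_mem hy _
  refine ⟨w, ?_, hK.of_isClosed_subset (isClosed_tsupport w) hsupp, hsupp.trans hKU,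
    fun x hx => indicator_of_mem hx _, fun x hx => ?_⟩
  · rw [contDiff_iff_contDiffAt]
    intro x
    by_cases hxU : x ∈ U
    · exact ((contDiff_softCut hε).contDiffAt.comp x
        (hu1.contDiffAt (hU.mem_nhds hxU))).congr_of_eventuallyEq (hev x hxU)
    · refine (contDiffAt_const (c := (0 : ℝ))).congr_of_eventuallyEq ?_
      filter_upwards [hK.isClosed.isOpen_compl.mem_nhds fun h => hxU (hKU h)] with y hy
        using hwK y hy
  · have hd : HasFDerivAt u (fderiv ℝ u x) x :=
      ((hu1.contDiffAt (hU.mem_nhds hx)).differentiableAt one_ne_zero).hasFDerivAt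
    rw [(hev x hx).fderiv_eq, ((hasDerivAt_softCut hε (u x)).comp_hasFDerivAt x hd).fderiv,
      norm_smul]
    exact mul_le_of_le_one_left (norm_nonneg _) (abs_softCutDeriv_le_one hε _)

/-- inequality (3.8): Let `Ω ⊂ ℝⁿ` be a bounded domain with
(Lipschitz) boundary, `β > α ≥ 0`, `β ≥ 2` and `α + β = n`.  Then for every
`1 ≤ q < ∞` there is `C > 0` such that for every `u ∈ C²(Ω̄)` with `u` and `∇u`
vanishing on `∂Ω`, `‖u‖_{L^q(Ω)} ≤ C [u]_{S̊₂}`, where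
`[u]_{S̊₂} = (∑ i ∫_Ω |u|^α |D_i² u|^β)^{1/(α+β)}`. -/
theorem stmt_5 (n : ℕ) (hn : 2 ≤ n) (Ω : Set (Fin n → ℝ))
    (hΩ_open : IsOpen Ω) (hΩ_bdd : Bornology.IsBounded Ω) (hΩ_conn : IsConnected Ω)
    (α β : ℝ) (hα : 0 ≤ α) (hαβ : α < β) (hβ : 2 ≤ β) (hαβn : α + β = (n : ℝ))
    (q : ℝ) (hq : 1 ≤ q) :
    ∃ C : ℝ, 0 < C ∧
      ∀ u : (Fin n → ℝ) → ℝ, ContDiffOn ℝ 2 u (closure Ω) →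
        (∀ x ∈ frontier Ω, u x = 0) → (∀ x ∈ frontier Ω, fderiv ℝ u x = 0) →
        (∫ x in Ω, |u x| ^ q) ^ (1 / q) ≤
          C * (∑ i : Fin n, ∫ x in Ω, |u x| ^ α *
            |fderiv ℝ (fun y => fderiv ℝ u y (Pi.single i 1)) x (Pi.single i 1)| ^ β)
            ^ (1 / (α + β)) := by
  obtain ⟨m, rfl⟩ : ∃ m, n = m + 2 := ⟨n - 2, by omega⟩
  have hq0 : 0 < q := by linarith
  have hs : α + β = m + 2 := by rw [hαβn]; push_cast; rfl
  obtain ⟨R, hR, hRΩ⟩ := hΩ_bdd.exists_pos_norm_le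
  choose P hP0 hP using fun i : Fin (m + 2) =>
    exists_setIntegral_abs_pow_le (volume : Measure (Fin (m + 2) → ℝ)) m hR
      (e := Pi.single i 1) (l := ContinuousLinearMap.proj i) (by simp)
  choose K hK0 hK using fun i : Fin (m + 2) =>
    exists_setIntegral_abs_deriv_pow_le (volume : Measure (Fin (m + 2) → ℝ)) m hα hαβ.le
      (by linarith) hs (hP0 i)
  obtain ⟨C, hC0, hC⟩ := exists_setIntegral_rpow_le_setIntegral_fderiv
    (volume : Measure (Fin (m + 2) → ℝ)) (m := m) (by simp) hΩ_bdd hq0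
  set D : ℝ := ((m : ℝ) + 2) ^ (m + 1) * ∑ i, K i with hD
  have hD0 : 0 ≤ D := mul_nonneg (by positivity) (Finset.sum_nonneg fun i _ => (hK0 i).le)
  refine ⟨C * D ^ (1 / (α + β)) + 1, by positivity, fun u hu h0 _ => ?_⟩
  set v : Fin (m + 2) → (Fin (m + 2) → ℝ) → ℝ := fun i x => fderiv ℝ u x (Pi.single i 1) with hv
  set w : Fin (m + 2) → (Fin (m + 2) → ℝ) → ℝ :=
    fun i x => fderiv ℝ (fun y => fderiv ℝ u y (Pi.single i 1)) x (Pi.single i 1) with hw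
  -- regularity in `Ω`
  have hcd : ∀ x ∈ Ω, ContDiffAt ℝ 2 u x := fun x hx =>
    hu.contDiffAt (Filter.mem_of_superset (hΩ_open.mem_nhds hx) subset_closure)
  have hcd1 : ∀ x ∈ Ω, ContDiffAt ℝ 1 (fderiv ℝ u) x := fun x hx =>
    (hcd x hx).fderiv_right (by norm_num [one_add_one_eq_two])
  have hcd0 : ∀ x ∈ Ω, ContDiffAt ℝ 0 (fderiv ℝ (fderiv ℝ u)) x := fun x hx =>
    (hcd1 x hx).fderiv_right (by norm_num)
  have hwfd : ∀ i, ∀ x ∈ Ω, w i x = fderiv ℝ (fderiv ℝ u) x (Pi.single i 1) (Pi.single i 1) :=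
    fun i x hx => by
      simp only [hw]
      rw [fderiv_clm_apply ((hcd1 x hx).differentiableAt one_ne_zero)
        (differentiableAt_const _)]
      simp
  obtain ⟨M, hM⟩ := exists_bound_fderiv_fderiv hΩ_open hΩ_bdd hu
  have he : ∀ i : Fin (m + 2), ‖(Pi.single i 1 : Fin (m + 2) → ℝ)‖ = 1 := fun i => by
    rw [Pi.norm_single, norm_one]
  have hvB : ∀ i, BoundedContinuousOn (v i) Ω := fun i =>
    ⟨fun x hx => ((hcd1 x hx).continuousAt.clm_apply continuousAt_const).continuousWithinAt,
      M, fun x hx => by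
        have := (fderiv ℝ u x).le_opNorm (Pi.single i 1)
        rw [he, mul_one] at this
        exact this.trans (hM x hx).1⟩
  have hwB : ∀ i, BoundedContinuousOn (w i) Ω := fun i => by
    refine ⟨ContinuousOn.congr (f := fun x => fderiv ℝ (fderiv ℝ u) x (Pi.single i 1) (Pi.single i 1))
      (fun x hx => (((hcd0 x hx).continuousAt.clm_apply continuousAt_const).clm_apply
        continuousAt_const).continuousWithinAt) (hwfd i), M, fun x hx => ?_⟩
    rw [hwfd i x hx]
    have := (fderiv ℝ (fderiv ℝ u) x).le_opNorm₂ (Pi.single i 1) (Pi.single i 1)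
    rw [he, mul_one, mul_one] at this
    exact this.trans (hM x hx).2
  have hdu : ∀ i, ∀ x ∈ Ω, HasLineDerivAt ℝ u (v i x) x (Pi.single i 1) := fun i x hx =>
    ((hcd x hx).differentiableAt two_ne_zero).hasFDerivAt.hasLineDerivAt _
  have hdv : ∀ i, ∀ x ∈ Ω, HasLineDerivAt ℝ (v i) (w i x) x (Pi.single i 1) := fun i x hx =>
    ((((hcd1 x hx).differentiableAt one_ne_zero).clm_apply
      (differentiableAt_const _)).hasFDerivAt.hasLineDerivAt _)
  have huc : ContinuousOn u (closure Ω) := hu.continuousOn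
  obtain ⟨B, hB⟩ := hΩ_bdd.isCompact_closure.exists_bound_of_continuousOn huc
  have huB : BoundedContinuousOn u Ω :=
    ⟨huc.mono subset_closure, B, fun x hx => hB x (subset_closure hx)⟩
  -- restriction to the open set where `u` does not vanish
  set U : Set (Fin (m + 2) → ℝ) := Ω ∩ u ⁻¹' {0}ᶜ with hUdef
  have hUΩ : U ⊆ Ω := inter_subset_left
  have hU : IsOpen U := huB.1.isOpen_inter_preimage hΩ_open isOpen_compl_singleton
  have hUb : Bornology.IsBounded U := hΩ_bdd.subset hUΩ
  have hUu : ContinuousOn u (closure U) := huc.mono (closure_mono hUΩ)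
  have hne : ∀ x ∈ U, u x ≠ 0 := fun x hx => hx.2
  have hU0 : ∀ x ∈ frontier U, u x = 0 := fun x hx => by
    rw [hU.frontier_eq] at hx
    by_cases hxΩ : x ∈ Ω
    · by_contra h
      exact hx.2 ⟨hxΩ, h⟩
    · exact h0 x (by rw [hΩ_open.frontier_eq]; exact ⟨closure_mono hUΩ hx.1, hxΩ⟩)
  set A : Fin (m + 2) → ℝ := fun i => ∫ x in Ω, |u x| ^ α * |w i x| ^ β with hA
  have hA0 : ∀ i, 0 ≤ A i := fun i => integral_nonneg fun x => by positivity
  have hG : ∀ i, ∫ x in U, |v i x| ^ (m + 2) ≤ K i * A i := fun i => by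
    refine (hK i U hU hUb _ u (v i) (w i) hUu hU0 hne ((hvB i).mono hUΩ) ((hwB i).mono hUΩ)
      (fun x hx => hdu i x hx.1) (fun x hx => hdv i x hx.1)
      (hP i U hU hUb (fun x hx => (norm_le_pi_norm x i).trans (hRΩ x hx.1)) u (v i) hUu hU0 hne
        ((hvB i).mono hUΩ) fun x hx => hdu i x hx.1)).trans ?_
    refine mul_le_mul_of_nonneg_left (setIntegral_mono_set ?_ ?_ ?_) (hK0 i).le
    · exact ((huB.comp (φ := fun s => |s| ^ α)
        (continuous_abs.rpow_const fun _ => Or.inr hα)).mul ((hwB i).comp (φ := fun s => |s| ^ β)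
        (continuous_abs.rpow_const fun _ => Or.inr (by linarith)))).integrableOn hΩ_open
        hΩ_bdd.measure_lt_top.ne
    · exact ae_of_all _ fun x => by positivity
    · exact hUΩ.eventuallyLE
  have hGsum : ∑ i, ∫ x in U, |v i x| ^ (m + 2) ≤ (∑ i, K i) * ∑ i, A i := by
    rw [Finset.sum_mul]
    refine Finset.sum_le_sum fun i _ => (hG i).trans (mul_le_mul_of_nonneg_left ?_ (hK0 i).le)
    exact Finset.single_le_sum (f := A) (fun j _ => hA0 j) (Finset.mem_univ i)
  -- the estimate for the truncations
  have htrunc : ∀ ε : ℝ, 0 < ε → (∫ x in Ω, |softCut ε (u x)| ^ q) ^ (1 / q) ≤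
      C * (D * ∑ i, A i) ^ (1 / ((m : ℝ) + 2)) := fun ε hε => by
    obtain ⟨z, hz, hzc, hzU, hzu, hzd⟩ := exists_contDiff_truncation hU hUb hUu hU0
      (fun x hx => ((hcd x (hUΩ hx)).of_le one_le_two).contDiffWithinAt) hε
    have hzeq : ∀ x ∈ Ω, |softCut ε (u x)| ^ q = |z x| ^ q := fun x hx => by
      by_cases hxU : x ∈ U
      · rw [hzu x hxU]
      · have hux : u x = 0 := by
          by_contra h
          exact hxU ⟨hx, h⟩
        rw [hux, softCut_eq_zero hε (by simpa using hε.le),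
          image_eq_zero_of_notMem_tsupport fun h => hxU (hzU h)]
    rw [setIntegral_congr_fun hΩ_open.measurableSet hzeq]
    refine (hC z hz hzc (hzU.trans hUΩ)).trans (mul_le_mul_of_nonneg_left ?_ hC0)
    refine Real.rpow_le_rpow (integral_nonneg fun x => by positivity) ?_ (by positivity)
    rw [setIntegral_eq_of_subset_of_forall_sdiff_eq_zero hΩ_open.measurableSet hUΩ fun x hx => by
      rw [image_eq_zero_of_notMem_tsupport (f := fderiv ℝ z)
        fun h => hx.2 (hzU (tsupport_fderiv_subset ℝ h))]
      simp]
    have hvI : ∀ i, IntegrableOn (fun x => |v i x| ^ (m + 2)) U := fun i =>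
      (((hvB i).mono hUΩ).comp (φ := fun s => |s| ^ (m + 2)) (by fun_prop)).integrableOn hU
        hUb.measure_lt_top.ne
    have hsI : IntegrableOn (fun x => ((m : ℝ) + 2) ^ (m + 1) * ∑ i, |v i x| ^ (m + 2)) U :=
      (integrable_finsetSum _ fun i _ => hvI i).const_mul _
    have hzI : IntegrableOn (fun x => ‖fderiv ℝ z x‖ ^ (m + 2)) U :=
      (((hz.continuous_fderiv one_ne_zero).norm.pow (m + 2)).integrable_of_hasCompactSupport
        ((hzc.fderiv (𝕜 := ℝ)).comp_left (g := fun L => ‖L‖ ^ (m + 2)) (by simp))).integrableOn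
    refine (setIntegral_mono_on hzI hsI hU.measurableSet fun x hx => ?_).trans ?_
    · have h1 : ‖fderiv ℝ z x‖ ≤ ∑ i, |v i x| :=
        (hzd x hx).trans (norm_le_sum_abs_apply_single _)
      refine (pow_le_pow_left₀ (norm_nonneg _) h1 _).trans ?_
      simpa using pow_sum_le_card_mul_sum_pow (s := Finset.univ) (f := fun i => |v i x|)
        (fun i _ => abs_nonneg _) (m + 1)
    · rw [integral_const_mul, integral_finsetSum _ fun i _ => hvI i, hD, mul_assoc]
      exact mul_le_mul_of_nonneg_left hGsum (by positivity)
  -- passage to the limit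
  have hpos : ∀ k : ℕ, (0 : ℝ) < 1 / ((k : ℝ) + 1) := fun k => by positivity
  have hint : Filter.Tendsto (fun k : ℕ => ∫ x in Ω, |softCut (1 / ((k : ℝ) + 1)) (u x)| ^ q)
      Filter.atTop (nhds (∫ x in Ω, |u x| ^ q)) := by
    have hφ : Continuous fun s : ℝ => |s| ^ q := continuous_abs.rpow_const fun _ => Or.inr hq0.le
    refine tendsto_integral_of_dominated_convergence (fun x => |u x| ^ q) (fun k => ?_)
      ((huB.comp hφ).integrableOn hΩ_open hΩ_bdd.measure_lt_top.ne)
      (fun k => ae_of_all _ fun x => ?_) (ae_of_all _ fun x => ?_)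
    · exact ((hφ.comp (contDiff_softCut (hpos k)).continuous).comp_continuousOn
        huB.1).aestronglyMeasurable hΩ_open.measurableSet
    · rw [Real.norm_of_nonneg (by positivity)]
      exact Real.rpow_le_rpow (abs_nonneg _) (abs_softCut_le (hpos k) _) hq0.le
    · exact (hφ.tendsto _).comp (tendsto_softCut hpos tendsto_one_div_add_atTop_nhds_zero_nat _)
  have hlim := le_of_tendsto' (hint.rpow_const (p := 1 / q) (Or.inr (by positivity)))
    fun k => htrunc _ (hpos k)
  have hS0 : 0 ≤ ∑ i, A i := Finset.sum_nonneg fun i _ => hA0 i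
  refine hlim.trans ?_
  rw [← hs, Real.mul_rpow hD0 hS0, ← mul_assoc]
  exact mul_le_mul_of_nonneg_right (by linarith) (by positivity)
end

section
/- Let β > 1, let τ ∈ ((β−1)/(β+1), (β−1)/β], let θ > 0 be a constant, and define u₀(x) = x^τ and u₁(x) = θ on (0,1). Then u₀ and u₁ both belong to S_{1,1,β}(0,1), i.e. ∫_0^1 |u₀|^{β+1} dx + ∫_0^1 |u₀| |u₀'|^β dx < ∞ and ∫_0^1 |u₁|^{β+1} dx + ∫_0^1 |u₁| |u₁'|^β dx < ∞, but their sum u = u₀ + u₁ does not: ∫_0^1 (x^τ + θ) |τ x^{τ−1}|^β dx = ∞. Consequently S_{1,1,β}(0,1) is not closed under addition (it is a nonlinear space). -/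
open MeasureTheory Real Set

theorem abs_mul_rpow_sub_one_rpow {x τ : ℝ} (hx : 0 < x) (hτ : 0 < τ) (β : ℝ) :
    |τ * x ^ (τ - 1)| ^ β = τ ^ β * x ^ ((τ - 1) * β) := by
  rw [abs_of_pos (by positivity), mul_rpow hτ.le (by positivity), ← rpow_mul hx.le]

theorem lintegral_ofReal_rpow_eq_top {s : ℝ} (hs : s ≤ -1) :
    ∫⁻ x in Ioo (0 : ℝ) 1, ENNReal.ofReal (x ^ s) = ⊤ := by
  by_contra h
  have hint : IntegrableOn (fun x : ℝ => x ^ s) (Ioo 0 1) := by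
    refine ⟨(measurable_id.pow_const s).aestronglyMeasurable, ?_⟩
    rw [hasFiniteIntegral_iff_ofReal]
    · exact lt_top_iff_ne_top.mpr h
    · filter_upwards [ae_restrict_mem measurableSet_Ioo] with x hx
      exact rpow_nonneg hx.1.le s
  exact absurd ((intervalIntegral.integrableOn_Ioo_rpow_iff one_pos).mp hint) (not_lt.mpr hs)

/-- Example 3.1: Let `β > 1`, `τ ∈ ((β-1)/(β+1), (β-1)/β]`,
`θ > 0`, `u₀(x) = x^τ`, `u₁(x) = θ` on `(0,1)`.  Then `u₀, u₁ ∈ S_{1,1,β}(0,1)`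
(their defining integrals are finite), but the sum `u = u₀ + u₁` satisfies
`∫_0^1 (x^τ + θ)|τ x^{τ-1}|^β dx = ∞`, so `S_{1,1,β}(0,1)` is not closed under
addition: it is a nonlinear space. -/
theorem stmt_12 (β τ θ : ℝ) (hβ : 1 < β)
    (hτ₁ : (β - 1) / (β + 1) < τ) (hτ₂ : τ ≤ (β - 1) / β) (hθ : 0 < θ) :
    -- u₀(x) = x^τ belongs to S_{1,1,β}(0,1):
    (IntegrableOn (fun x : ℝ => |x ^ τ| ^ (β + 1)) (Ioo 0 1) ∧
     IntegrableOn (fun x : ℝ => |x ^ τ| * |τ * x ^ (τ - 1)| ^ β) (Ioo 0 1)) ∧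
    -- u₁(x) = θ belongs to S_{1,1,β}(0,1):
    (IntegrableOn (fun _ : ℝ => |θ| ^ (β + 1)) (Ioo (0 : ℝ) 1) ∧
     IntegrableOn (fun _ : ℝ => |θ| * |(0 : ℝ)| ^ β) (Ioo (0 : ℝ) 1)) ∧
    -- but u = u₀ + u₁ does not: its gradient integral diverges:
    (∫⁻ x in Ioo (0 : ℝ) 1, ENNReal.ofReal ((x ^ τ + θ) * |τ * x ^ (τ - 1)| ^ β)) = ⊤ := by
  have hβ0 : 0 < β := by linarith
  have hτ0 : 0 < τ := lt_of_le_of_lt (div_nonneg (by linarith) (by linarith)) hτ₁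
  rw [div_lt_iff₀ (by linarith)] at hτ₁
  rw [le_div_iff₀ hβ0] at hτ₂
  refine ⟨⟨?_, ?_⟩, ⟨?_, ?_⟩, ?_⟩
  · have h : IntegrableOn (fun x : ℝ => x ^ (τ * (β + 1))) (Ioo 0 1) :=
      (intervalIntegral.integrableOn_Ioo_rpow_iff one_pos).mpr (by nlinarith)
    refine h.congr_fun (fun x hx => ?_) measurableSet_Ioo
    have hx0 : 0 < x := hx.1
    simp only [abs_of_pos (rpow_pos_of_pos hx0 τ), rpow_mul hx0.le]
  · have h : IntegrableOn (fun x : ℝ => x ^ (τ + (τ - 1) * β)) (Ioo 0 1) :=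
      (intervalIntegral.integrableOn_Ioo_rpow_iff one_pos).mpr (by nlinarith)
    refine IntegrableOn.congr_fun (h.const_mul (τ ^ β)) (fun x hx => ?_) measurableSet_Ioo
    have hx0 : 0 < x := hx.1
    simp only [abs_of_pos (rpow_pos_of_pos hx0 τ), abs_mul_rpow_sub_one_rpow hx0 hτ0,
      rpow_add hx0]
    ring
  · exact integrableOn_const (by simp)
  · exact integrableOn_const (by simp)
  · have hc : 0 < θ * τ ^ β := by positivity
    rw [eq_top_iff]
    calc (⊤ : ENNReal)
        = ENNReal.ofReal (θ * τ ^ β) *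
            ∫⁻ x in Ioo (0 : ℝ) 1, ENNReal.ofReal (x ^ ((τ - 1) * β)) := by
          rw [lintegral_ofReal_rpow_eq_top (by nlinarith),
            ENNReal.mul_top (ENNReal.ofReal_pos.mpr hc).ne']
      _ = ∫⁻ x in Ioo (0 : ℝ) 1, ENNReal.ofReal (θ * τ ^ β * x ^ ((τ - 1) * β)) := by
          rw [← lintegral_const_mul' _ _ ENNReal.ofReal_ne_top]
          simp only [ENNReal.ofReal_mul hc.le]
      _ ≤ _ := by
          refine setLIntegral_mono' measurableSet_Ioo fun x hx => ENNReal.ofReal_le_ofReal ?_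
          have hx0 : 0 < x := hx.1
          rw [abs_mul_rpow_sub_one_rpow hx0 hτ0, mul_assoc]
          gcongr
          linarith [rpow_pos_of_pos hx0 τ]
end
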